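/- arXiv:1606.07036 — 6 statements merged into one kernel-verified Lean document; each statement's English description precedes it below -/
import Mathlib

section
/- Let 0 < p < 1, q = 1 - p, and -1 ≤ ρ < 1. There exists a probability vector (p00, p01, p10, p11) of nonnegative reals summing to 1 satisfying the marginal constraints p10 + p11 = p and p01 + p11 = p and the covariance constraint p11 - p^2 = p*q*ρ if and only if max{0, -ρ/(1-ρ)} ≤ p ≤ min{1, 1/(1-ρ)}. -/
/-- For `0 < p < 1`, `q = 1 - p`, `-1 ≤ ρ < 1`, a probability vector
`(p00, p01, p10, p11)` with marginals `p` and covariance `p*q*ρ` exists iff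
`max 0 (-ρ/(1-ρ)) ≤ p ≤ min 1 (1/(1-ρ))`. -/
theorem stmt_0 (p q ρ : ℝ) (hp0 : 0 < p) (hp1 : p < 1) (hq : q = 1 - p)
    (hρ1 : -1 ≤ ρ) (hρ2 : ρ < 1) :
    (∃ p00 p01 p10 p11 : ℝ,
      0 ≤ p00 ∧ 0 ≤ p01 ∧ 0 ≤ p10 ∧ 0 ≤ p11 ∧
      p00 + p01 + p10 + p11 = 1 ∧
      p10 + p11 = p ∧ p01 + p11 = p ∧
      p11 - p ^ 2 = p * q * ρ) ↔
    (max 0 (-ρ / (1 - ρ)) ≤ p ∧ p ≤ min 1 (1 / (1 - ρ))) := by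
  have h1 : 0 < 1 - ρ := by linarith
  have hq0 : 0 < 1 - p := by linarith
  subst hq
  rw [max_le_iff, le_min_iff, div_le_iff₀ h1, le_div_iff₀ h1]
  constructor
  · rintro ⟨p00, p01, p10, p11, h00, h01, h10, h11, hs, ha, hb, hc⟩
    have e11 : p11 = p * (p * (1 - ρ) + ρ) := by linear_combination hc
    have e00 : p00 = (1 - p) * (1 - p * (1 - ρ)) := by
      linear_combination hs - ha - hb + hc
    rw [e11] at h11
    rw [e00] at h00
    have k1 := nonneg_of_mul_nonneg_right h11 hp0
    have k2 := nonneg_of_mul_nonneg_right h00 hq0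
    refine ⟨⟨hp0.le, by linarith⟩, hp1.le, by linarith⟩
  · rintro ⟨⟨_, ha⟩, _, hb⟩
    refine ⟨(1 - p) * (1 - p * (1 - ρ)), p * (1 - p) * (1 - ρ), p * (1 - p) * (1 - ρ),
      p * (p * (1 - ρ) + ρ), mul_nonneg hq0.le (by linarith), by positivity, by positivity,
      mul_nonneg hp0.le (by linarith), by ring, by ring, by ring, by ring⟩
end

section
/- Let (Ω, μ) be a finite probability space, let X : Ω → F_2, let U : Ω → S for a finite type S, and let G1, G2 : Ω → F_2 be such that P(G1 = 1) = p and the pair (G1, G2) is independent (as a joint random variable) of the pair (X, U). Then the conditional Shannon entropy satisfies H[G1·X | (U, G1, G2)] = p · H[X | U], where G1·X denotes the pointwise product in F_2. -/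
open Classical in
/-- Probability of an event on a finite probability space with weights `μ`. -/
noncomputable def pr {Ω : Type*} [Fintype Ω] (μ : Ω → ℝ) (E : Ω → Prop) : ℝ :=
  ∑ ω, if E ω then μ ω else 0

/-- Conditional Shannon entropy `H[X | Y]` (natural logarithm):
`∑_y P(Y = y) · H[X | Y = y]`. -/
noncomputable def condEnt {Ω A B : Type*} [Fintype Ω] [Fintype A] [Fintype B]
    (μ : Ω → ℝ) (X : Ω → A) (Y : Ω → B) : ℝ :=
  ∑ b, ∑ a, pr μ (fun ω => Y ω = b) *
    Real.negMulLog (pr μ (fun ω => X ω = a ∧ Y ω = b) / pr μ (fun ω => Y ω = b))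

/-- Conditional mutual information `I[X : Y | Z]` (natural logarithm). -/
noncomputable def condMI {Ω A B C : Type*} [Fintype Ω] [Fintype A] [Fintype B] [Fintype C]
    (μ : Ω → ℝ) (X : Ω → A) (Y : Ω → B) (Z : Ω → C) : ℝ :=
  condEnt μ X Z + condEnt μ Y Z - condEnt μ (fun ω => (X ω, Y ω)) Z

/-- Two (finite-valued) random variables are independent. -/
def IndepRV {Ω A B : Type*} [Fintype Ω] (μ : Ω → ℝ) (X : Ω → A) (Y : Ω → B) : Prop :=
  ∀ a b, pr μ (fun ω => X ω = a ∧ Y ω = b) =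
    pr μ (fun ω => X ω = a) * pr μ (fun ω => Y ω = b)

theorem pr_congr_aux {Ω : Type*} [Fintype Ω] (μ : Ω → ℝ) {E F : Ω → Prop}
    (h : ∀ ω, E ω ↔ F ω) : pr μ E = pr μ F := by
  have : E = F := funext fun ω => propext (h ω)
  rw [this]

theorem pr_false_aux {Ω : Type*} [Fintype Ω] (μ : Ω → ℝ) {E : Ω → Prop}
    (h : ∀ ω, ¬ E ω) : pr μ E = 0 := by
  simp [pr, h]

theorem pr_marg_aux {Ω A : Type*} [Fintype Ω] [Fintype A] (μ : Ω → ℝ) (E : Ω → Prop)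
    (X : Ω → A) : pr μ E = ∑ a, pr μ (fun ω => E ω ∧ X ω = a) := by
  classical
  unfold pr
  rw [Finset.sum_comm]
  refine Finset.sum_congr rfl fun ω _ => ?_
  by_cases h : E ω <;> simp [h]

/-- On a finite probability space, if `P(G1 = 1) = p` and the pair
`(G1, G2)` is independent of the pair `(X, U)`, then
`H[G1·X | (U, G1, G2)] = p · H[X | U]`. -/
theorem stmt_3 {Ω S : Type*} [Fintype Ω] [Fintype S]
    (μ : Ω → ℝ) (hμ0 : ∀ ω, 0 ≤ μ ω) (hμ1 : ∑ ω, μ ω = 1)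
    (p : ℝ)
    (X : Ω → ZMod 2) (U : Ω → S) (G1 G2 : Ω → ZMod 2)
    (hp : pr μ (fun ω => G1 ω = 1) = p)
    (hIndep : IndepRV μ (fun ω => (G1 ω, G2 ω)) (fun ω => (X ω, U ω))) :
    condEnt μ (fun ω => G1 ω * X ω) (fun ω => (U ω, G1 ω, G2 ω)) =
      p * condEnt μ X U := by
  have hpair : ∀ g1 g2 x u, pr μ (fun ω => (G1 ω = g1 ∧ G2 ω = g2) ∧ (X ω = x ∧ U ω = u)) =
      pr μ (fun ω => G1 ω = g1 ∧ G2 ω = g2) * pr μ (fun ω => X ω = x ∧ U ω = u) := by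
    intro g1 g2 x u
    have h := hIndep (g1, g2) (x, u)
    simpa only [Prod.mk.injEq] using h
  have hU : ∀ u, pr μ (fun ω => U ω = u) = ∑ x, pr μ (fun ω => X ω = x ∧ U ω = u) := by
    intro u
    rw [pr_marg_aux μ _ X]
    exact Finset.sum_congr rfl fun x _ => pr_congr_aux μ fun ω => and_comm
  have hs : ∀ u g1 g2, pr μ (fun ω => (U ω, G1 ω, G2 ω) = (u, g1, g2)) =
      pr μ (fun ω => G1 ω = g1 ∧ G2 ω = g2) * pr μ (fun ω => U ω = u) := by
    intro u g1 g2
    rw [hU, Finset.mul_sum, pr_marg_aux μ _ X]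
    refine Finset.sum_congr rfl fun x _ => ?_
    rw [← hpair]
    refine pr_congr_aux μ fun ω => ?_
    simp only [Prod.mk.injEq]
    tauto
  have hterm1 : ∀ u g2 a, pr μ (fun ω => (U ω, G1 ω, G2 ω) = (u, 1, g2)) *
      Real.negMulLog (pr μ (fun ω => G1 ω * X ω = a ∧ (U ω, G1 ω, G2 ω) = (u, 1, g2)) /
        pr μ (fun ω => (U ω, G1 ω, G2 ω) = (u, 1, g2))) =
      pr μ (fun ω => G1 ω = 1 ∧ G2 ω = g2) * (pr μ (fun ω => U ω = u) *
        Real.negMulLog (pr μ (fun ω => X ω = a ∧ U ω = u) / pr μ (fun ω => U ω = u))) := by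
    intro u g2 a
    have h : pr μ (fun ω => G1 ω * X ω = a ∧ (U ω, G1 ω, G2 ω) = (u, 1, g2)) =
        pr μ (fun ω => G1 ω = 1 ∧ G2 ω = g2) * pr μ (fun ω => X ω = a ∧ U ω = u) := by
      rw [← hpair]
      refine pr_congr_aux μ fun ω => ?_
      simp only [Prod.mk.injEq]
      constructor
      · rintro ⟨h1, h2, h3, h4⟩
        rw [h3, one_mul] at h1
        exact ⟨⟨h3, h4⟩, h1, h2⟩
      · rintro ⟨⟨h3, h4⟩, h1, h2⟩
        exact ⟨by rw [h3, one_mul, h1], h2, h3, h4⟩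
    rw [h, hs]
    by_cases hq : pr μ (fun ω => G1 ω = 1 ∧ G2 ω = g2) = 0
    · simp [hq]
    · rw [mul_div_mul_left _ _ hq, mul_assoc]
  have hterm0 : ∀ u g2 a, pr μ (fun ω => (U ω, G1 ω, G2 ω) = (u, 0, g2)) *
      Real.negMulLog (pr μ (fun ω => G1 ω * X ω = a ∧ (U ω, G1 ω, G2 ω) = (u, 0, g2)) /
        pr μ (fun ω => (U ω, G1 ω, G2 ω) = (u, 0, g2))) = 0 := by
    intro u g2 a
    by_cases ha : a = 0
    · have h : pr μ (fun ω => G1 ω * X ω = a ∧ (U ω, G1 ω, G2 ω) = (u, 0, g2)) =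
          pr μ (fun ω => (U ω, G1 ω, G2 ω) = (u, 0, g2)) := by
        refine pr_congr_aux μ fun ω => ?_
        simp only [Prod.mk.injEq]
        constructor
        · exact fun h => h.2
        · exact fun h => ⟨by rw [h.2.1, zero_mul, ha], h⟩
      rw [h]
      by_cases hq : pr μ (fun ω => (U ω, G1 ω, G2 ω) = (u, 0, g2)) = 0
      · rw [hq, zero_mul]
      · rw [div_self hq]; simp
    · have h : pr μ (fun ω => G1 ω * X ω = a ∧ (U ω, G1 ω, G2 ω) = (u, 0, g2)) = 0 := by
        refine pr_false_aux μ fun ω => ?_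
        simp only [Prod.mk.injEq]
        rintro ⟨h1, -, h2, -⟩
        rw [h2, zero_mul] at h1
        exact ha h1.symm
      rw [h, zero_div, Real.negMulLog_zero, mul_zero]
  have hz : ∀ f : ZMod 2 → ℝ, ∑ g, f g = f 0 + f 1 := fun f => Fin.sum_univ_two f
  have hp2 : p = ∑ g2, pr μ (fun ω => G1 ω = 1 ∧ G2 ω = g2) := by
    rw [← hp]; exact pr_marg_aux μ _ G2
  unfold condEnt
  rw [Fintype.sum_prod_type, Finset.mul_sum]
  refine Finset.sum_congr rfl fun u _ => ?_
  rw [Fintype.sum_prod_type, hz]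
  simp only [hterm0, hterm1, Finset.sum_const_zero, zero_add]
  rw [hp2, Finset.sum_mul]
  refine Finset.sum_congr rfl fun g2 _ => ?_
  rw [Finset.mul_sum]
end

section
/- Let (Ω, μ) be a finite probability space, 0 < p ≤ 1, q = 1 - p, -1 ≤ ρ ≤ 1, and set β = 2 - p - q*ρ. Let X : Ω → F_2, let U : Ω → S and V : Ω → T for finite types S, T, and let (G1, G2) be a (p,ρ)-correlated Bernoulli pair of F_2-valued random variables that is independent of the triple (X, U, V). Then H[G2·X | (U, G1, G2)] ≥ (1/β) · H[(G1·X, G2·X) | (U, V, G1, G2)]. -/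
section helpers

variable {Ω : Type*} [Fintype Ω] (μ : Ω → ℝ)

lemma pr_congr' {E F : Ω → Prop} (h : ∀ ω, E ω ↔ F ω) : pr μ E = pr μ F := by
  have : E = F := funext fun ω => propext (h ω)
  rw [this]

lemma pr_nonneg' (h0 : ∀ ω, 0 ≤ μ ω) (E : Ω → Prop) : 0 ≤ pr μ E := by
  unfold pr
  refine Finset.sum_nonneg fun ω _ => ?_
  split_ifs
  · exact h0 ω
  · exact le_rfl

lemma pr_mono' (h0 : ∀ ω, 0 ≤ μ ω) {E F : Ω → Prop} (h : ∀ ω, E ω → F ω) :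
    pr μ E ≤ pr μ F := by
  unfold pr
  refine Finset.sum_le_sum fun ω _ => ?_
  by_cases hE : E ω
  · simp [hE, h ω hE]
  · by_cases hF : F ω <;> simp [hE, hF, h0 ω]

lemma pr_false' {E : Ω → Prop} (h : ∀ ω, ¬ E ω) : pr μ E = 0 := by
  unfold pr
  exact Finset.sum_eq_zero fun ω _ => by simp [h ω]

lemma pr_marg' {C : Type*} [Fintype C] (E : Ω → Prop) (Y : Ω → C) :
    pr μ E = ∑ c, pr μ (fun ω => E ω ∧ Y ω = c) := by
  classical
  unfold pr
  rw [Finset.sum_comm]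
  refine Finset.sum_congr rfl fun ω _ => ?_
  by_cases h : E ω <;> simp [h]

lemma pr_indep' {Γ D : Type*} [Fintype D] (G : Ω → Γ) (Z : Ω → D)
    (h : IndepRV μ G Z) (g : Γ) (P : D → Prop) :
    pr μ (fun ω => G ω = g ∧ P (Z ω)) = pr μ (fun ω => G ω = g) * pr μ (fun ω => P (Z ω)) := by
  classical
  rw [pr_marg' μ _ Z, pr_marg' μ (fun ω => P (Z ω)) Z, Finset.mul_sum]
  refine Finset.sum_congr rfl fun d _ => ?_
  by_cases hP : P d
  · rw [pr_congr' μ (F := fun ω => G ω = g ∧ Z ω = d),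
      pr_congr' μ (E := fun ω => P (Z ω) ∧ Z ω = d) (F := fun ω => Z ω = d)]
    · exact h g d
    · intro ω; constructor
      · exact fun h => h.2
      · rintro rfl; exact ⟨hP, rfl⟩
    · intro ω; constructor
      · exact fun h => ⟨h.1.1, h.2⟩
      · rintro ⟨h1, rfl⟩; exact ⟨⟨h1, hP⟩, rfl⟩
  · rw [pr_false', pr_false' μ (E := fun ω => P (Z ω) ∧ Z ω = d), mul_zero]
    · rintro ω ⟨h1, rfl⟩; exact hP h1
    · rintro ω ⟨h1, rfl⟩; exact hP h1.2

/-- Splitting off an independent conditioning variable. -/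
lemma condEnt_split' {Γ D A C : Type*} [Fintype Γ] [Fintype D] [Fintype A] [Fintype C]
    (G : Ω → Γ) (Z : Ω → D) (h : IndepRV μ G Z) (F : Γ → D → A) (w : D → C) :
    condEnt μ (fun ω => F (G ω) (Z ω)) (fun ω => (w (Z ω), G ω)) =
      ∑ g, pr μ (fun ω => G ω = g) * condEnt μ (fun ω => F g (Z ω)) (fun ω => w (Z ω)) := by
  unfold condEnt
  rw [Fintype.sum_prod_type, Finset.sum_comm]
  refine Finset.sum_congr rfl fun g _ => ?_
  rw [Finset.mul_sum]
  refine Finset.sum_congr rfl fun c _ => ?_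
  rw [Finset.mul_sum]
  refine Finset.sum_congr rfl fun a _ => ?_
  have e1 : pr μ (fun ω => (w (Z ω), G ω) = (c, g)) =
      pr μ (fun ω => G ω = g) * pr μ (fun ω => w (Z ω) = c) := by
    rw [← pr_indep' μ G Z h g (fun d => w d = c)]
    exact pr_congr' μ fun ω => by rw [Prod.mk.injEq]; exact and_comm
  have e2 : pr μ (fun ω => F (G ω) (Z ω) = a ∧ (w (Z ω), G ω) = (c, g)) =
      pr μ (fun ω => G ω = g) * pr μ (fun ω => F g (Z ω) = a ∧ w (Z ω) = c) := by
    rw [← pr_indep' μ G Z h g (fun d => F g d = a ∧ w d = c)]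
    refine pr_congr' μ fun ω => ?_
    rw [Prod.mk.injEq]
    constructor
    · rintro ⟨h1, h2, rfl⟩; exact ⟨rfl, h1, h2⟩
    · rintro ⟨rfl, h1, h2⟩; exact ⟨h1, h2, rfl⟩
  rw [e1, e2]
  by_cases h0 : pr μ (fun ω => G ω = g) = 0
  · simp [h0]
  · rw [mul_div_mul_left _ _ h0, mul_assoc]

lemma condEnt_const' {A C : Type*} [Fintype A] [Fintype C] (a₀ : A) (W : Ω → C) :
    condEnt μ (fun _ => a₀) W = 0 := by
  unfold condEnt
  refine Finset.sum_eq_zero fun c _ => Finset.sum_eq_zero fun a _ => ?_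
  by_cases ha : a₀ = a
  · rw [pr_congr' μ (E := fun ω => a₀ = a ∧ W ω = c) (F := fun ω => W ω = c)
      (fun ω => by simp [ha])]
    by_cases h0 : pr μ (fun ω => W ω = c) = 0
    · simp [h0]
    · simp [div_self h0]
  · rw [pr_false' μ (E := fun ω => a₀ = a ∧ W ω = c) (fun ω h => ha h.1)]
    simp

lemma condEnt_inj' {A B C : Type*} [Fintype A] [Fintype B] [Fintype C] (f : A → B)
    (hf : Function.Injective f) (X : Ω → A) (W : Ω → C) :
    condEnt μ (fun ω => f (X ω)) W = condEnt μ X W := by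
  unfold condEnt
  refine Finset.sum_congr rfl fun c _ => ?_
  symm
  refine Fintype.sum_of_injective f hf _ _ ?_ ?_
  · intro b hb
    rw [pr_false' μ (E := fun ω => f (X ω) = b ∧ W ω = c) (fun ω h => hb ⟨_, h.1⟩)]
    simp
  · intro a
    rw [pr_congr' μ (E := fun ω => f (X ω) = f a ∧ W ω = c) (F := fun ω => X ω = a ∧ W ω = c)
      (fun ω => by rw [hf.eq_iff])]

/-- Conditioning reduces entropy. -/
lemma condEnt_le' {A S T : Type*} [Fintype A] [Fintype S] [Fintype T] (h0 : ∀ ω, 0 ≤ μ ω)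
    (X : Ω → A) (U : Ω → S) (V : Ω → T) :
    condEnt μ X (fun ω => (U ω, V ω)) ≤ condEnt μ X U := by
  unfold condEnt
  rw [Fintype.sum_prod_type]
  refine Finset.sum_le_sum fun u _ => ?_
  rw [Finset.sum_comm]
  refine Finset.sum_le_sum fun a _ => ?_
  set P := pr μ (fun ω => U ω = u) with hP
  have hm : P = ∑ v, pr μ (fun ω => (U ω, V ω) = (u, v)) := by
    rw [hP, pr_marg' μ _ V]
    exact Finset.sum_congr rfl fun v _ => pr_congr' μ fun ω => by rw [Prod.mk.injEq]
  have hm2 : pr μ (fun ω => X ω = a ∧ U ω = u) =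
      ∑ v, pr μ (fun ω => X ω = a ∧ (U ω, V ω) = (u, v)) := by
    rw [pr_marg' μ _ V]
    exact Finset.sum_congr rfl fun v _ => pr_congr' μ fun ω => by rw [Prod.mk.injEq, and_assoc]
  have hn : ∀ v, 0 ≤ pr μ (fun ω => (U ω, V ω) = (u, v)) := fun v => pr_nonneg' μ h0 _
  have hPn : 0 ≤ P := pr_nonneg' μ h0 _
  rcases hPn.eq_or_lt with hz | hpos
  · have : ∀ v, pr μ (fun ω => (U ω, V ω) = (u, v)) = 0 := by
      intro v
      exact (Finset.sum_eq_zero_iff_of_nonneg (fun v _ => hn v)).1 (hm.symm.trans hz.symm) v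
        (Finset.mem_univ v)
    simp only [this, ← hz, zero_mul, Finset.sum_const_zero, le_refl]
  · have J := Real.concaveOn_negMulLog.le_map_sum (t := Finset.univ)
      (w := fun v => pr μ (fun ω => (U ω, V ω) = (u, v)) / P)
      (p := fun v => pr μ (fun ω => X ω = a ∧ (U ω, V ω) = (u, v)) /
        pr μ (fun ω => (U ω, V ω) = (u, v)))
      (fun v _ => div_nonneg (hn v) hPn)
      (by rw [← Finset.sum_div, ← hm, div_self hpos.ne'])
      (fun v _ => div_nonneg (pr_nonneg' μ h0 _) (hn v))
    have e : ∑ v, (pr μ (fun ω => (U ω, V ω) = (u, v)) / P) •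
        (pr μ (fun ω => X ω = a ∧ (U ω, V ω) = (u, v)) /
        pr μ (fun ω => (U ω, V ω) = (u, v))) = pr μ (fun ω => X ω = a ∧ U ω = u) / P := by
      rw [hm2, Finset.sum_div]
      refine Finset.sum_congr rfl fun v _ => ?_
      rw [smul_eq_mul]
      by_cases hv : pr μ (fun ω => (U ω, V ω) = (u, v)) = 0
      · have : pr μ (fun ω => X ω = a ∧ (U ω, V ω) = (u, v)) = 0 :=
          le_antisymm (hv ▸ pr_mono' μ h0 fun ω h => h.2) (pr_nonneg' μ h0 _)
        simp only [hv, this, zero_div, zero_mul]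
      · field_simp
    rw [e] at J
    have J2 := mul_le_mul_of_nonneg_left J hPn
    refine le_trans (le_of_eq ?_) J2
    rw [Finset.mul_sum]
    refine Finset.sum_congr rfl fun v _ => ?_
    rw [smul_eq_mul, ← mul_assoc, mul_div_cancel₀ _ hpos.ne']

/-- Reassociating the conditioning variable. -/
lemma condEnt_equiv' {A B C : Type*} [Fintype A] [Fintype B] [Fintype C] (e : B ≃ C)
    (X : Ω → A) (W : Ω → B) :
    condEnt μ X (fun ω => e (W ω)) = condEnt μ X W := by
  unfold condEnt
  rw [← Equiv.sum_comp e]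
  simp only [e.apply_eq_iff_eq]

end helpers

/-- On a finite probability space, for `0 < p ≤ 1`, `q = 1 - p`,
`-1 ≤ ρ ≤ 1` and `β = 2 - p - qρ`, if `(G1, G2)` is a `(p,ρ)`-correlated Bernoulli pair
independent of the triple `(X, U, V)`, then
`H[G2·X | (U, G1, G2)] ≥ (1/β) · H[(G1·X, G2·X) | (U, V, G1, G2)]`. -/
theorem stmt_5 {Ω S T : Type*} [Fintype Ω] [Fintype S] [Fintype T]
    (μ : Ω → ℝ) (hμ0 : ∀ ω, 0 ≤ μ ω) (hμ1 : ∑ ω, μ ω = 1)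
    (p q ρ β : ℝ) (hp0 : 0 < p) (hp1 : p ≤ 1) (hq : q = 1 - p)
    (hρ1 : -1 ≤ ρ) (hρ2 : ρ ≤ 1) (hβ : β = 2 - p - q * ρ)
    (X : Ω → ZMod 2) (U : Ω → S) (V : Ω → T) (G1 G2 : Ω → ZMod 2)
    (hpG1 : pr μ (fun ω => G1 ω = 1) = p)
    (hpG2 : pr μ (fun ω => G2 ω = 1) = p)
    (hcorr : pr μ (fun ω => G1 ω = 1 ∧ G2 ω = 1) = p ^ 2 + p * q * ρ)
    (hIndep : IndepRV μ (fun ω => (G1 ω, G2 ω)) (fun ω => (X ω, U ω, V ω))) :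
    condEnt μ (fun ω => G2 ω * X ω) (fun ω => (U ω, G1 ω, G2 ω)) ≥
      (1 / β) * condEnt μ (fun ω => (G1 ω * X ω, G2 ω * X ω))
        (fun ω => (U ω, V ω, G1 ω, G2 ω)) := by
  have hLr : condEnt μ (fun ω => G2 ω * X ω) (fun ω => (U ω, G1 ω, G2 ω)) = _ :=
    condEnt_split' μ (fun ω => (G1 ω, G2 ω)) (fun ω => (X ω, U ω, V ω)) hIndep
      (fun g d => g.2 * d.1) (fun d => d.2.1)
  have hRr0 := condEnt_split' μ (fun ω => (G1 ω, G2 ω)) (fun ω => (X ω, U ω, V ω)) hIndep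
      (fun g d => (g.1 * d.1, g.2 * d.1)) (fun d => d.2)
  have hRr := (condEnt_equiv' μ (Equiv.prodAssoc S T (ZMod 2 × ZMod 2))
    (fun ω => (G1 ω * X ω, G2 ω * X ω)) (fun ω => ((U ω, V ω), (G1 ω, G2 ω)))).trans hRr0
  simp only [Equiv.prodAssoc_apply] at hRr
  rw [hLr, hRr]
  have huniv : ∀ f : ZMod 2 → ℝ, ∑ x, f x = f 0 + f 1 := fun f => Fin.sum_univ_two f
  simp only [Fintype.sum_prod_type, huniv]
  simp only [zero_mul, one_mul, condEnt_const']
  have i1 := condEnt_inj' μ (fun x : ZMod 2 => ((0 : ZMod 2), x))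
    (fun x y h => (Prod.mk.inj h).2) X (fun ω => (U ω, V ω))
  have i2 := condEnt_inj' μ (fun x : ZMod 2 => (x, (0 : ZMod 2)))
    (fun x y h => (Prod.mk.inj h).1) X (fun ω => (U ω, V ω))
  have i3 := condEnt_inj' μ (fun x : ZMod 2 => (x, x))
    (fun x y h => (Prod.mk.inj h).1) X (fun ω => (U ω, V ω))
  rw [i1, i2, i3]
  have g11 : pr μ (fun ω => (G1 ω, G2 ω) = (1, 1)) = p ^ 2 + p * q * ρ := by
    rw [← hcorr]; exact pr_congr' μ fun ω => by rw [Prod.mk.injEq]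
  have g10 : pr μ (fun ω => (G1 ω, G2 ω) = (1, 0)) = p - (p ^ 2 + p * q * ρ) := by
    have := pr_marg' μ (fun ω => G1 ω = 1) G2
    rw [huniv, hpG1, hcorr] at this
    rw [pr_congr' μ (F := fun ω => G1 ω = 1 ∧ G2 ω = 0) (fun ω => by rw [Prod.mk.injEq])]
    linarith
  have g01 : pr μ (fun ω => (G1 ω, G2 ω) = (0, 1)) = p - (p ^ 2 + p * q * ρ) := by
    have := pr_marg' μ (fun ω => G2 ω = 1) G1
    rw [huniv, hpG2, pr_congr' μ (E := fun ω => G2 ω = 1 ∧ G1 ω = 1) (fun ω => and_comm),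
      hcorr] at this
    rw [pr_congr' μ (F := fun ω => G2 ω = 1 ∧ G1 ω = 0)
      (fun ω => by rw [Prod.mk.injEq]; exact and_comm)]
    linarith
  rw [g11, g10, g01]
  have hβpos : 0 < β := by
    have : 0 ≤ q * (1 - ρ) := mul_nonneg (by linarith) (by linarith)
    rw [hβ]; nlinarith
  have key := condEnt_le' μ hμ0 X U V
  have hk := mul_le_mul_of_nonneg_left key hp0.le
  rw [ge_iff_le]
  refine le_trans (le_of_eq ?_) (hk.trans (le_of_eq ?_))
  · rw [one_div, inv_mul_eq_iff_eq_mul₀ hβpos.ne', hβ, hq]; ring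
  · ring
end

section
/- Let 0 < p ≤ 1, q = 1 - p, -1 ≤ ρ ≤ 1, and β = 2 - p - q*ρ. Set r = min{p, β(1 - q^2)/(1 + β)}. Then (r, r) belongs to the region C(p, ρ), and for every real R with (R, R) ∈ C(p, ρ) one has R ≤ r; i.e., r is the maximum symmetric rate of the region. -/
/-- The region `C(p, ρ)` of Theorem 1: rate pairs `(R₁, R₂)` with `0 ≤ Rᵢ ≤ p` and
`Rᵢ + β·R_{3-i} ≤ β(1 - q²)` where `q = 1 - p` and `β = 2 - p - qρ`. -/
def capacityRegion (p ρ : ℝ) : Set (ℝ × ℝ) :=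
  {R : ℝ × ℝ |
    0 ≤ R.1 ∧ R.1 ≤ p ∧ 0 ≤ R.2 ∧ R.2 ≤ p ∧
    R.1 + (2 - p - (1 - p) * ρ) * R.2 ≤ (2 - p - (1 - p) * ρ) * (1 - (1 - p) ^ 2) ∧
    R.2 + (2 - p - (1 - p) * ρ) * R.1 ≤ (2 - p - (1 - p) * ρ) * (1 - (1 - p) ^ 2)}

/-- `r = min {p, β(1 - q²)/(1 + β)}` is the maximum symmetric rate of
the region `C(p, ρ)`. -/
theorem stmt_10 (p q ρ β r : ℝ) (hp0 : 0 < p) (hp1 : p ≤ 1) (hq : q = 1 - p)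
    (hρ1 : -1 ≤ ρ) (hρ2 : ρ ≤ 1) (hβ : β = 2 - p - q * ρ)
    (hr : r = min p (β * (1 - q ^ 2) / (1 + β))) :
    (r, r) ∈ capacityRegion p ρ ∧
      ∀ R : ℝ, (R, R) ∈ capacityRegion p ρ → R ≤ r := by
  subst hq
  have hβ1 : 1 ≤ β := by
    rw [hβ]
    nlinarith [mul_nonneg (sub_nonneg.2 hp1) (sub_nonneg.2 hρ2)]
  have hpos : 0 < 1 + β := by linarith
  have hS : 0 ≤ 1 - (1 - p) ^ 2 := by nlinarith
  have hr1 : r ≤ p := hr ▸ min_le_left _ _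
  have hr2 : r ≤ β * (1 - (1 - p) ^ 2) / (1 + β) := hr ▸ min_le_right _ _
  have hr0 : 0 ≤ r := by
    rw [hr]
    exact le_min hp0.le (div_nonneg (mul_nonneg (by linarith) hS) hpos.le)
  rw [le_div_iff₀ hpos] at hr2
  unfold capacityRegion
  simp only [Set.mem_setOf_eq]
  rw [← hβ]
  refine ⟨⟨hr0, hr1, hr0, hr1, by linarith, by linarith⟩, ?_⟩
  rintro R ⟨_, h1, _, _, h2, _⟩
  rw [hr]
  refine le_min h1 ?_
  rw [le_div_iff₀ hpos]
  linarith
end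

section
/- Let 0 < p ≤ 1 and let -1 ≤ ρ_1 ≤ ρ_2 ≤ 1. Then the region C(p, ρ_2) is contained in the region C(p, ρ_1). In particular, for fixed p, decreasing the spatial correlation coefficient ρ enlarges the region and (weakly) increases the maximum achievable sum-rate. -/
/-- for fixed `0 < p ≤ 1`, the region `C(p, ρ)` is monotone: if
`-1 ≤ ρ₁ ≤ ρ₂ ≤ 1` then `C(p, ρ₂) ⊆ C(p, ρ₁)`. -/
theorem stmt_11 (p ρ₁ ρ₂ : ℝ) (hp0 : 0 < p) (hp1 : p ≤ 1)
    (h1 : -1 ≤ ρ₁) (h12 : ρ₁ ≤ ρ₂) (h2 : ρ₂ ≤ 1) :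
    capacityRegion p ρ₂ ⊆ capacityRegion p ρ₁ := by
  rintro ⟨x, y⟩ ⟨hx0, hxp, hy0, hyp, hA, hB⟩
  simp only at hx0 hxp hy0 hyp hA hB
  have hA' : p ≤ 1 - (1 - p) ^ 2 := by nlinarith
  have hβ : 0 ≤ (1 - p) * (ρ₂ - ρ₁) := mul_nonneg (by linarith) (by linarith)
  have ex := mul_nonneg hβ (show 0 ≤ 1 - (1 - p) ^ 2 - x by linarith)
  have ey := mul_nonneg hβ (show 0 ≤ 1 - (1 - p) ^ 2 - y by linarith)
  refine ⟨hx0, hxp, hy0, hyp, ?_, ?_⟩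
  · show x + (2 - p - (1 - p) * ρ₁) * y ≤ (2 - p - (1 - p) * ρ₁) * (1 - (1 - p) ^ 2)
    linarith
  · show y + (2 - p - (1 - p) * ρ₁) * x ≤ (2 - p - (1 - p) * ρ₁) * (1 - (1 - p) ^ 2)
    linarith
end

section
/- Let 0 < p ≤ 1, q = 1 - p, -1 ≤ ρ ≤ 1, and β = 2 - p - q*ρ. The point (p, p) belongs to the region C(p, ρ) if and only if q·β ≥ 1, that is, if and only if q·(2 - p - q·ρ) ≥ 1. In particular, for p = 1/2 the point (1/2, 1/2) belongs to C(1/2, ρ) if and only if ρ = -1; i.e., full negative spatial correlation is exactly the condition under which delayed CSIT achieves the per-user rate p possible with instantaneous CSIT. -/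
/-- `(p, p) ∈ C(p, ρ)` iff `q·β ≥ 1`, i.e. `q·(2 - p - q·ρ) ≥ 1`;
in particular for `p = 1/2`, `(1/2, 1/2) ∈ C(1/2, ρ')` iff `ρ' = -1`. -/
theorem stmt_12 (p q ρ β : ℝ) (hp0 : 0 < p) (hp1 : p ≤ 1) (hq : q = 1 - p)
    (hρ1 : -1 ≤ ρ) (hρ2 : ρ ≤ 1) (hβ : β = 2 - p - q * ρ) :
    ((p, p) ∈ capacityRegion p ρ ↔ q * β ≥ 1) ∧
      (∀ ρ' : ℝ, -1 ≤ ρ' → ρ' ≤ 1 →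
        (((1 : ℝ) / 2, (1 : ℝ) / 2) ∈ capacityRegion (1 / 2) ρ' ↔ ρ' = -1)) := by
  constructor
  · subst hq
    have key : p + β * p ≤ β * (1 - (1 - p) ^ 2) ↔ (1 - p) * β ≥ 1 := by
      have e : β * (1 - (1 - p) ^ 2) - (p + β * p) = p * ((1 - p) * β - 1) := by ring
      rw [← sub_nonneg, e, mul_nonneg_iff_of_pos_left hp0, sub_nonneg]
    simp only [capacityRegion, Set.mem_setOf_eq, ← hβ]
    constructor
    · rintro ⟨-, -, -, -, h, -⟩
      exact key.mp h
    · intro h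
      exact ⟨hp0.le, le_rfl, hp0.le, le_rfl, key.mpr h, key.mpr h⟩
  · intro r h1 h2
    simp only [capacityRegion, Set.mem_setOf_eq]
    constructor
    · rintro ⟨-, -, -, -, h, -⟩
      linarith
    · rintro rfl
      norm_num
end
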